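/- Let K be an algebraically closed field of characteristic zero and let F = x·y^{k-1}·z^{k+2} + y^{2k}·z² ∈ K[x,y,z] with k ≥ 1. In every expression of F as a linear combination of (2k+2)-nd powers of linear forms with nonzero coefficients, at least k² + 3k of the base linear forms have nonzero coefficient of x. -/

import Mathlib

open MvPolynomial

/-- A linear form is the sum of the variables weighted by its coefficients. -/
lemma MvPolynomial.IsHomogeneous.eq_sum_coeff_smul_X {σ R : Type*} [Fintype σ] [CommSemiring R]
    {p : MvPolynomial σ R} (hp : p.IsHomogeneous 1) :
    p = ∑ j, p.coeff (Finsupp.single j 1) • X j := by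
  classical
  ext m
  simp only [coeff_sum, coeff_smul, coeff_X, smul_eq_mul, mul_ite, mul_one, mul_zero]
  by_cases hm : m.degree = 1
  · obtain ⟨j, rfl⟩ := (Finsupp.sum_eq_one_iff m).mp hm
    simp [Finsupp.single_left_inj]
  · rw [hp.coeff_eq_zero hm, eq_comm]
    refine Finset.sum_eq_zero fun j _ ↦ if_neg ?_
    rintro rfl
    simp at hm

/-- If a weighted sum of point evaluations in the plane kills every monomial of degree at most
`m + n` other than `y ^ m * z ^ n`, which it does not kill, then it involves at least
`(m + 1) * (n + 1)` points: the monomials dividing `y ^ m * z ^ n` are linearly independent as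
functions on the points. -/
lemma succ_mul_succ_le_card_of_moments {K ι : Type*} [Field K] [Fintype ι] {m n : ℕ}
    {w u v : ι → K}
    (hzero : ∀ p q, p + q ≤ m + n → (p, q) ≠ (m, n) → ∑ i, w i * (u i ^ p * v i ^ q) = 0)
    (hne : ∑ i, w i * (u i ^ m * v i ^ n) ≠ 0) :
    (m + 1) * (n + 1) ≤ Fintype.card ι := by
  have hli : LinearIndependent K
      (fun (a : Fin (m + 1) × Fin (n + 1)) (i : ι) ↦ u i ^ (a.1 : ℕ) * v i ^ (a.2 : ℕ)) := by
    rw [Fintype.linearIndependent_iff]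
    intro g hg
    suffices H : ∀ N, ∀ a : Fin (m + 1) × Fin (n + 1),
        m + n - (a.1 + a.2 : ℕ) = N → g a = 0 from fun a ↦ H _ a rfl
    intro N
    induction N using Nat.strong_induction_on with
    | _ N ih =>
      rintro a rfl
      have hsum : ∑ b, g b * ∑ i, w i *
          (u i ^ (b.1 + (m - a.1) : ℕ) * v i ^ (b.2 + (n - a.2) : ℕ)) = 0 := by
        simp_rw [Finset.mul_sum]
        rw [Finset.sum_comm]
        refine Finset.sum_eq_zero fun i _ ↦ ?_
        have hi := congrFun hg i
        simp only [Finset.sum_apply, Pi.smul_apply, smul_eq_mul, Pi.zero_apply] at hi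
        rw [← mul_zero (w i * (u i ^ (m - a.1 : ℕ) * v i ^ (n - a.2 : ℕ))), ← hi,
          Finset.mul_sum]
        refine Finset.sum_congr rfl fun b _ ↦ ?_
        ring
      have ha1 : (a.1 : ℕ) ≤ m := Nat.lt_succ_iff.mp a.1.2
      have ha2 : (a.2 : ℕ) ≤ n := Nat.lt_succ_iff.mp a.2.2
      rw [Finset.sum_eq_single a] at hsum
      · rw [Nat.add_sub_cancel' ha1, Nat.add_sub_cancel' ha2] at hsum
        exact (mul_eq_zero.mp hsum).resolve_right hne
      · intro b _ hba
        have hb1 := b.1.2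
        have hb2 := b.2.2
        by_cases hdeg : (a.1 + a.2 : ℕ) < b.1 + b.2
        · rw [ih _ (by omega) b rfl, zero_mul]
        · rw [hzero _ _ (by omega), mul_zero]
          intro h
          rw [Prod.mk.injEq] at h
          exact hba (Prod.ext (Fin.ext (by omega)) (Fin.ext (by omega)))
      · exact fun h ↦ absurd (Finset.mem_univ a) h
  simpa using hli.fintype_card_le_finrank

/-- If the part of `∑ i, c i • ℓ i ^ (m + n + 1)` divisible by `x` is the monomial
`x * y ^ m * z ^ n`, then at least `(m + 1) * (n + 1)` of the linear forms `ℓ i` involve `x`. -/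
lemma succ_mul_succ_le_ncard_of_sum_pow {K : Type*} [Field K] [CharZero K] {m n r : ℕ}
    {c : Fin r → K} {ℓ : Fin r → MvPolynomial (Fin 3) K} {G : MvPolynomial (Fin 3) K}
    (hhom : ∀ i, (ℓ i).IsHomogeneous 1)
    (hG : ∀ s : Fin 3 →₀ ℕ, s 0 ≠ 0 → G.coeff s = 0)
    (hdec : X 0 * X 1 ^ m * X 2 ^ n + G = ∑ i, c i • ℓ i ^ (m + n + 1)) :
    (m + 1) * (n + 1) ≤
      ({i : Fin r | (ℓ i).coeff (Finsupp.single 0 1) ≠ 0} : Set (Fin r)).ncard := by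
  classical
  set a : Fin r → Fin 3 → K := fun i j ↦ (ℓ i).coeff (Finsupp.single j 1) with ha
  have hmoment : ∀ p q, p + q ≤ m + n →
      ∃ M : K, M ≠ 0 ∧ M * ∑ i : {i // a i 0 ≠ 0}, (c i * a i 0 ^ (m + n + 1)) *
        ((a i 1 / a i 0) ^ p * (a i 2 / a i 0) ^ q) = if (p, q) = (m, n) then 1 else 0 := by
    intro p q hpq
    obtain ⟨t, ht⟩ := Nat.exists_eq_add_of_le hpq
    let s : Fin 3 →₀ ℕ := Finsupp.equivFunOnFinite.symm ![t + 1, p, q]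
    have hs : s.sum (fun _ e ↦ e) = m + n + 1 := by
      rw [Finsupp.sum_fintype _ _ (fun _ ↦ rfl)]
      simp [s, Fin.sum_univ_three]
      omega
    refine ⟨s.multinomial, Nat.cast_ne_zero.mpr ?_, ?_⟩
    · exact (Nat.multinomial_pos _ _).ne'
    have hcoeff := congrArg (coeff s) hdec
    rw [coeff_add, hG s (by simp [s]), add_zero] at hcoeff
    have hmono : (X 0 * X 1 ^ m * X 2 ^ n : MvPolynomial (Fin 3) K) =
        monomial (Finsupp.equivFunOnFinite.symm ![1, m, n]) 1 := by
      rw [monomial_eq, Finsupp.prod_fintype _ _ (fun _ ↦ pow_zero _)]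
      simp [Fin.prod_univ_three]
    have hiff : Finsupp.equivFunOnFinite.symm ![1, m, n] = s ↔ (p, q) = (m, n) := by
      simp only [s, EmbeddingLike.apply_eq_iff_eq, Prod.mk.injEq]
      constructor
      · intro h
        exact ⟨(congrFun h 1).symm, (congrFun h 2).symm⟩
      · rintro ⟨rfl, rfl⟩
        obtain rfl : t = 0 := by omega
        rfl
    rw [hmono, coeff_monomial] at hcoeff
    simp only [hiff] at hcoeff
    rw [hcoeff, coeff_sum, Finset.mul_sum]
    have hterm : ∀ i, coeff s (c i • ℓ i ^ (m + n + 1)) =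
        s.multinomial * (c i * (a i 0 ^ (t + 1) * a i 1 ^ p * a i 2 ^ q)) := by
      intro i
      rw [coeff_smul, (hhom i).eq_sum_coeff_smul_X, coeff_linearCombination_X_pow_of_fintype,
        if_pos hs, Finsupp.prod_fintype _ _ (fun _ ↦ pow_zero _)]
      simp [s, Fin.prod_univ_three, ha]
      ring
    simp only [hterm]
    rw [← Finset.sum_filter_of_ne (p := fun i ↦ a i 0 ≠ 0),
      Finset.sum_subtype (p := fun i ↦ a i 0 ≠ 0) _ (by simp)]
    · refine Finset.sum_congr rfl fun i _ ↦ ?_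
      have hi := i.2
      rw [show m + n + 1 = (t + 1) + p + q by omega]
      simp only [div_pow, pow_add]
      field_simp
    · intro i _ hi h0
      simp [h0] at hi
  have hcard := succ_mul_succ_le_card_of_moments (m := m) (n := n)
    (w := fun i : {i // a i 0 ≠ 0} ↦ c i * a i 0 ^ (m + n + 1))
    (u := fun i ↦ a i 1 / a i 0) (v := fun i ↦ a i 2 / a i 0) ?_ ?_
  · rwa [← Nat.card_eq_fintype_card] at hcard
  · intro p q hpq hne
    obtain ⟨M, hM, h⟩ := hmoment p q hpq
    rw [if_neg hne] at h
    exact (mul_eq_zero.mp h).resolve_left hM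
  · obtain ⟨M, hM, h⟩ := hmoment m n le_rfl
    rw [if_pos rfl] at h
    exact right_ne_zero_of_mul (h ▸ one_ne_zero)

/-- In every power sum decomposition (with nonzero coefficients) of
`F = x·y^{k-1}·z^{k+2} + y^{2k}·z²` into `(2k+2)`-nd powers of linear forms,
at least `k² + 3k` of the base linear forms have nonzero coefficient of `x`. -/
theorem count_forms_with_x_for_F (K : Type*) [Field K] [IsAlgClosed K] [CharZero K]
    (k : ℕ) (hk : 1 ≤ k)
    (r : ℕ) (c : Fin r → K) (ℓ : Fin r → MvPolynomial (Fin 3) K)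
    (hc : ∀ i, c i ≠ 0)
    (hhom : ∀ i, (ℓ i).IsHomogeneous 1)
    (hdec : (X 0 * X 1 ^ (k - 1) * X 2 ^ (k + 2) + X 1 ^ (2 * k) * X 2 ^ 2 :
        MvPolynomial (Fin 3) K) = ∑ i, c i • ℓ i ^ (2 * k + 2)) :
    k ^ 2 + 3 * k ≤
      ({i : Fin r | (ℓ i).coeff (Finsupp.single 0 1) ≠ 0} : Set (Fin r)).ncard := by
  obtain ⟨k, rfl⟩ := Nat.exists_eq_add_of_le' hk
  have hmono : (X 1 ^ (2 * (k + 1)) * X 2 ^ 2 : MvPolynomial (Fin 3) K) =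
      monomial (Finsupp.equivFunOnFinite.symm ![0, 2 * (k + 1), 2]) 1 := by
    rw [monomial_eq, Finsupp.prod_fintype _ _ (fun _ ↦ pow_zero _)]
    simp [Fin.prod_univ_three]
  have hcard := succ_mul_succ_le_ncard_of_sum_pow (m := k) (n := k + 3) (c := c) (ℓ := ℓ)
    (G := X 1 ^ (2 * (k + 1)) * X 2 ^ 2) hhom ?_ ?_
  · exact (by ring : (k + 1) ^ 2 + 3 * (k + 1) = (k + 1) * (k + 3 + 1)).trans_le hcard
  · intro s hs
    rw [hmono, coeff_monomial, if_neg]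
    rintro rfl
    simp at hs
  · rw [show k + (k + 3) + 1 = 2 * (k + 1) + 2 by ring]
    exact hdec
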